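/- arXiv:2204.09499 — 3 statements merged into one kernel-verified Lean document; each statement's English description precedes it below -/
import Mathlib

section
/- A path ω ∈ Ω is S-random for a forecasting system φ if and only if no computable nonnegative supermartingale M for φ is computably unbounded on ω. -/
open Filter Classical

/-- Situations: finite binary strings. -/
abbrev Situation := List Bool

/-- Paths: infinite binary sequences. -/
abbrev BinPath := ℕ → Bool

/-- The length-`n` prefix `ω_{1:n}` of a path. -/
def pref (ω : BinPath) (n : ℕ) : Situation := List.ofFn (fun i : Fin n => ω i)

/-- The real value of a bit. -/
def bit (x : Bool) : ℝ := if x then 1 else 0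

/-- Local expectation `E_p(f) = p f(1) + (1-p) f(0)` of a gamble `f : Bool → ℝ`. -/
def localE (p : ℝ) (f : Bool → ℝ) : ℝ := p * f true + (1 - p) * f false

/-- Upper expectation of a gamble for interval forecast `[lo, hi]`. -/
def upperE (lo hi : ℝ) (f : Bool → ℝ) : ℝ := max (localE lo f) (localE hi f)

/-- A forecasting system, given by lower and upper bounds `lo hi : Situation → ℝ`,
is proper when `0 ≤ lo s ≤ hi s ≤ 1` everywhere. -/
def IsForecastingSystem (lo hi : Situation → ℝ) : Prop :=
  ∀ s, 0 ≤ lo s ∧ lo s ≤ hi s ∧ hi s ≤ 1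

/-- The process difference `ΔF(s) : x ↦ F(s·x) − F(s)`. -/
def diffP (F : Situation → ℝ) (s : Situation) : Bool → ℝ := fun x => F (s ++ [x]) - F s

/-- A supermartingale for the forecasting system `(lo, hi)`. -/
def IsSupermartingale (lo hi : Situation → ℝ) (F : Situation → ℝ) : Prop :=
  ∀ s, upperE (lo s) (hi s) (diffP F s) ≤ 0

/-- A test supermartingale: a nonnegative supermartingale starting at 1. -/
def IsTestSupermartingale (lo hi : Situation → ℝ) (F : Situation → ℝ) : Prop :=
  IsSupermartingale lo hi F ∧ (∀ s, 0 ≤ F s) ∧ F [] = 1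

/-- A real process is (positive) rational-valued and recursive. -/
def IsRecursiveRational (F : Situation → ℝ) : Prop :=
  ∃ q : Situation → ℚ, Computable q ∧ ∀ s, (q s : ℝ) = F s

/-- A real process is computable. -/
def IsComputableProcess (F : Situation → ℝ) : Prop :=
  ∃ q : Situation → ℕ → ℚ, Computable₂ q ∧
    ∀ s n, |F s - q s n| < (2 : ℝ) ^ (-(n : ℤ))

/-- A real process is lower semicomputable. -/
def IsLSCProcess (F : Situation → ℝ) : Prop :=
  ∃ q : Situation → ℕ → ℚ, Computable₂ q ∧
    (∀ s n, q s n ≤ q s (n + 1)) ∧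
    ∀ s, Tendsto (fun m => (q s m : ℝ)) atTop (nhds (F s))

/-- A (real) growth function: computable, nonnegative, nondecreasing and unbounded. -/
def IsGrowthFunction (τ : ℕ → ℝ) : Prop :=
  (∀ n, 0 ≤ τ n) ∧ (∀ n, τ n ≤ τ (n + 1)) ∧ Tendsto τ atTop atTop ∧
    ∃ q : ℕ → ℕ → ℚ, Computable₂ q ∧ ∀ n m, |τ n - q n m| < (2 : ℝ) ^ (-(m : ℤ))

/-- A real process is unbounded on a path: `limsup_n T(ω_{1:n}) = ∞`. -/
def UnboundedOn (T : Situation → ℝ) (ω : BinPath) : Prop :=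
  limsup (fun n => ((T (pref ω n) : ℝ) : EReal)) atTop = ⊤

/-- A real process is computably unbounded on a path:
`limsup_n [T(ω_{1:n}) − τ(n)] ≥ 0` for some growth function `τ`. -/
def ComputablyUnboundedOn (T : Situation → ℝ) (ω : BinPath) : Prop :=
  ∃ τ : ℕ → ℝ, IsGrowthFunction τ ∧
    0 ≤ limsup (fun n => ((T (pref ω n) - τ n : ℝ) : EReal)) atTop

/-- Computable randomness for the forecasting system `(lo, hi)`:
no recursive positive rational test supermartingale is unbounded on `ω`. -/
def CRandom (lo hi : Situation → ℝ) (ω : BinPath) : Prop :=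
  ∀ T : Situation → ℝ, IsRecursiveRational T → (∀ s, 0 < T s) →
    IsTestSupermartingale lo hi T → ¬ UnboundedOn T ω

/-- Schnorr randomness for the forecasting system `(lo, hi)`:
no recursive positive rational test supermartingale is computably unbounded on `ω`. -/
def SchnorrRandom (lo hi : Situation → ℝ) (ω : BinPath) : Prop :=
  ∀ T : Situation → ℝ, IsRecursiveRational T → (∀ s, 0 < T s) →
    IsTestSupermartingale lo hi T → ¬ ComputablyUnboundedOn T ω

/-- Martin-Löf randomness for the forecasting system `(lo, hi)`:
no lower semicomputable test supermartingale is unbounded on `ω`. -/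
def MLRandom (lo hi : Situation → ℝ) (ω : BinPath) : Prop :=
  ∀ T : Situation → ℝ, IsLSCProcess T →
    IsTestSupermartingale lo hi T → ¬ UnboundedOn T ω

/-- A selection process is temporal if its value depends only on the length. -/
def IsTemporal (S : Situation → Bool) : Prop :=
  ∀ s t : Situation, s.length = t.length → S s = S t

/-- Value of a selection process along a path. -/
def selVal (S : Situation → Bool) (ω : BinPath) (k : ℕ) : ℝ := if S (pref ω k) then 1 else 0

/-- `ω` is `𝒮`-random for the forecasting system `(lo, hi)`. -/
def SSetRandom (𝒮 : Set (Situation → Bool)) (lo hi : Situation → ℝ) (ω : BinPath) : Prop :=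
  ∀ S ∈ 𝒮,
    Tendsto (fun n => ∑ k ∈ Finset.range n, selVal S ω k) atTop atTop →
      0 ≤ liminf (fun n =>
          (((∑ k ∈ Finset.range n, selVal S ω k * (bit (ω k) - lo (pref ω k))) /
              (∑ k ∈ Finset.range n, selVal S ω k) : ℝ) : EReal)) atTop ∧
        limsup (fun n =>
          (((∑ k ∈ Finset.range n, selVal S ω k * (bit (ω k) - hi (pref ω k))) /
              (∑ k ∈ Finset.range n, selVal S ω k) : ℝ) : EReal)) atTop ≤ 0

/-- Weak Church randomness: the selection-process conditions hold for all
recursive temporal selection processes. -/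
def WCHRandom (lo hi : Situation → ℝ) (ω : BinPath) : Prop :=
  SSetRandom {S | Computable S ∧ IsTemporal S} lo hi ω

/-- Global upper expectation of a bounded global gamble `f : BinPath → ℝ`. -/
noncomputable def globalUpperE (lo hi : Situation → ℝ) (f : BinPath → ℝ) : ℝ :=
  sInf {m : ℝ | ∃ M : Situation → ℝ, IsSupermartingale lo hi M ∧ M [] = m ∧
    ∀ ω : BinPath, (f ω : EReal) ≤ liminf (fun n => ((M (pref ω n) : ℝ) : EReal)) atTop}

/-- Upper probability of an event. -/
noncomputable def upperProb (lo hi : Situation → ℝ) (A : Set BinPath) : ℝ :=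
  globalUpperE lo hi (Set.indicator A 1)

/-- An event is almost sure if its complement has upper probability zero. -/
def AlmostSure (lo hi : Situation → ℝ) (A : Set BinPath) : Prop :=
  upperProb lo hi Aᶜ = 0

/-- The set of recursive positive rational test processes `𝓕_C`. -/
def FsetC : Set (Situation → ℝ) :=
  {F | IsRecursiveRational F ∧ (∀ s, 0 < F s) ∧ F [] = 1}

/-- The set of lower semicomputable test processes `𝓕_ML`. -/
def FsetML : Set (Situation → ℝ) :=
  {F | IsLSCProcess F ∧ (∀ s, 0 ≤ F s) ∧ F [] = 1}

/-- The temporal selection process `S^r_F` associated with a real process `F`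
and a number `r`. -/
noncomputable def selProc (r : ℝ) (F : Situation → ℝ) : Situation → Bool := fun s =>
  if ∃ t : Situation, t.length = s.length ∧ 0 < localE r (diffP F t) then true else false

/-- The set of selection processes `𝒮^{p,q}_𝓕`. -/
def SelSet (p q : ℝ) (𝓕 : Set (Situation → ℝ)) : Set (Situation → Bool) :=
  {S | ∃ F ∈ 𝓕, ∃ r ∈ ({p, q} : Set ℝ), S = selProc r F}

/-- The temporal precise forecasting system `φ^ϖ_{p,q}`. -/
def tempFS (p q : ℝ) (ϖ : BinPath) : Situation → ℝ := fun s => if ϖ s.length then q else p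

/-- A test process `F` is generated by the multiplier process `D`. -/
def GeneratedBy (D : Situation → Bool → ℝ) (F : Situation → ℝ) : Prop :=
  F [] = 1 ∧ ∀ s x, F (s ++ [x]) = F s * D s x

/-- A lower semicomputable multiplier process: a nonnegative gamble process that
is lower semicomputable. -/
def IsLSCMultiplier (D : Situation → Bool → ℝ) : Prop :=
  (∀ s x, 0 ≤ D s x) ∧
  ∃ q : Situation → Bool → ℕ → ℚ,
    Computable (fun p : Situation × Bool × ℕ => q p.1 p.2.1 p.2.2) ∧
    (∀ s x n, q s x n ≤ q s x (n + 1)) ∧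
    ∀ s x, Tendsto (fun m => (q s x m : ℝ)) atTop (nhds (D s x))


section EncodeSection

open Encodable

/-- The range predicate of the raw encoding of `ℚ`. -/
def RR (k : ℕ) : Prop :=
  0 < k.unpair.2 ∧ ∀ y < k.unpair.2 + 1, y = 1 ∨ ((k.unpair.1 + 1) / 2) % y ≠ 0 ∨ k.unpair.2 % y ≠ 0

/-- The raw encoding of `ℚ`. -/
def ee (q : ℚ) : ℕ := Nat.pair (Equiv.intEquivNat q.num) q.den

lemma intEquivNat_ofNat (a : ℕ) : Equiv.intEquivNat (Int.ofNat a) = 2 * a := by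
  change Equiv.natSumNatEquivNat (Sum.inl a) = _
  simp

lemma intEquivNat_negSucc (a : ℕ) : Equiv.intEquivNat (Int.negSucc a) = 2 * a + 1 := by
  change Equiv.natSumNatEquivNat (Sum.inr a) = _
  simp

lemma intEquivNat_toNat (z : ℤ) :
    z.toNat = (Equiv.intEquivNat z / 2) * (1 - Equiv.intEquivNat z % 2) := by
  cases z with
  | ofNat a => rw [intEquivNat_ofNat]; simp
  | negSucc a => rw [intEquivNat_negSucc]; simp [Nat.add_mod]

lemma intEquivNat_neg_toNat (z : ℤ) :
    (-z).toNat = ((Equiv.intEquivNat z + 1) / 2) * (Equiv.intEquivNat z % 2) := by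
  cases z with
  | ofNat a => rw [intEquivNat_ofNat]; simp
  | negSucc a =>
    rw [intEquivNat_negSucc, Int.neg_negSucc]
    have h1 : (2 * a + 1 + 1) / 2 = a + 1 := by omega
    have h2 : (2 * a + 1) % 2 = 1 := by omega
    rw [h1, h2]; simp

lemma intEquivNat_natAbs (z : ℤ) : (Equiv.intEquivNat z + 1) / 2 = z.natAbs := by
  cases z with
  | ofNat a => rw [intEquivNat_ofNat]; simp; omega
  | negSucc a => rw [intEquivNat_negSucc]; simp; omega

lemma coprime_iff_bdd (x d : ℕ) (hd : 0 < d) :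
    Nat.Coprime x d ↔ ∀ y < d + 1, y = 1 ∨ x % y ≠ 0 ∨ d % y ≠ 0 := by
  constructor
  · intro h y _
    by_contra! hc
    obtain ⟨h1, h2, h3⟩ := hc
    exact h1 (Nat.eq_one_of_dvd_coprimes h (Nat.dvd_of_mod_eq_zero h2) (Nat.dvd_of_mod_eq_zero h3))
  · intro h
    have hg := Nat.gcd_dvd_right x d
    rcases h (Nat.gcd x d) (Nat.lt_succ_of_le (Nat.le_of_dvd hd hg)) with h | h | h
    · exact h
    · exact absurd (Nat.mod_eq_zero_of_dvd (Nat.gcd_dvd_left x d)) h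
    · exact absurd (Nat.mod_eq_zero_of_dvd hg) h

lemma RR_iff (k : ℕ) : RR k ↔ ∃ q, ee q = k := by
  constructor
  · rintro ⟨h1, h2⟩
    rw [← coprime_iff_bdd _ _ h1] at h2
    refine ⟨⟨Equiv.intEquivNat.symm k.unpair.1, k.unpair.2, h1.ne', ?_⟩, ?_⟩
    · rw [← intEquivNat_natAbs]; simpa using h2
    · simp [ee]
  · rintro ⟨q, rfl⟩
    have : 0 < (ee q).unpair.2 := by simp [ee, q.den_pos]
    refine ⟨this, ?_⟩
    rw [← coprime_iff_bdd _ _ this]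
    simp only [ee, Nat.unpair_pair, intEquivNat_natAbs]
    exact q.reduced

lemma encode_raw (q : ℚ) : @encode ℚ Rat.instEncodable q = ee q := by
  rfl

/-- The encoding of `ℚ` used by `Primcodable ℚ`. -/
def encQ (q : ℚ) : ℕ := @encode ℚ Primcodable.toEncodable q

lemma encode_rat (q : ℚ) : encQ q = Nat.count RR (ee q) := by
  have h : encQ q = (List.range (ee q)).countP (fun k => @decide
      (k ∈ Set.range (@encode ℚ Rat.instEncodable))
        (@decidableRangeEncode ℚ Rat.instEncodable k)) := by
    rfl
  rw [h, Nat.count_eq_card_filter_range, Finset.card_def, Finset.filter_val, Finset.range_val,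
    ← Multiset.coe_range, Multiset.filter_coe, Multiset.coe_card, List.countP_eq_length_filter]
  congr 2
  ext k
  refine decide_eq_decide.2 ?_
  rw [RR_iff]
  rfl

lemma primrec_RR : PrimrecPred RR := by
  have h1 : PrimrecRel (fun y k : ℕ => y = 1 ∨ ((k.unpair.1 + 1) / 2) % y ≠ 0
      ∨ k.unpair.2 % y ≠ 0) := by
    refine PrimrecPred.or ?_ (PrimrecPred.or ?_ ?_)
    · exact Primrec.eq.comp Primrec.fst (Primrec.const 1)
    · refine PrimrecPred.not (Primrec.eq.comp (Primrec.nat_mod.comp (Primrec.nat_div.comp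
        (Primrec.succ.comp ?_) (Primrec.const 2)) Primrec.fst) (Primrec.const 0))
      exact Primrec.fst.comp (Primrec.unpair.comp Primrec.snd)
    · exact PrimrecPred.not (Primrec.eq.comp (Primrec.nat_mod.comp
        (Primrec.snd.comp (Primrec.unpair.comp Primrec.snd)) Primrec.fst) (Primrec.const 0))
  have hd : Primrec (fun k : ℕ => k.unpair.2) := Primrec.snd.comp Primrec.unpair
  refine PrimrecPred.and (Primrec.nat_lt.comp (Primrec.const 0) hd) ?_
  exact (h1.forall_lt).comp (Primrec.succ.comp hd) Primrec.id

lemma primrec_count : Primrec (Nat.count RR) := by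
  refine (Primrec.list_length.comp ((Primrec.listFilter primrec_RR).comp
    Primrec.list_range)).of_eq fun n => ?_
  rw [Nat.count_eq_card_filter_range, Finset.card_def, Finset.filter_val, Finset.range_val,
    ← Multiset.coe_range, Multiset.filter_coe, Multiset.coe_card]

lemma computable_ee : Computable ee := by
  have hex : ∀ q : ℚ, ∃ k, RR k ∧ Nat.count RR k = encQ q := fun q =>
    ⟨ee q, (RR_iff _).2 ⟨q, rfl⟩, (encode_rat q).symm⟩
  have hP : PrimrecPred (fun p : ℚ × ℕ => RR p.2 ∧ Nat.count RR p.2 = encQ p.1) :=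
    PrimrecPred.and (primrec_RR.comp Primrec.snd)
      (Primrec.eq.comp (primrec_count.comp Primrec.snd) (Primrec.encode.comp Primrec.fst))
  refine (Computable.find hP.computablePred hex).of_eq fun q => ?_
  obtain ⟨h1, h2⟩ := Nat.find_spec (hex q)
  exact Nat.count_injective h1 ((RR_iff _).2 ⟨q, rfl⟩) (h2.trans (encode_rat q))

lemma computable_den : Computable (fun q : ℚ => q.den) :=
  ((Primrec.snd.comp Primrec.unpair).to_comp.comp computable_ee).of_eq fun q => by simp [ee]

lemma computable_pos : Computable (fun q : ℚ => q.num.toNat) := by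
  have h0 : Primrec (fun k : ℕ => k.unpair.1) := Primrec.fst.comp Primrec.unpair
  have h : Primrec (fun k : ℕ => (k.unpair.1 / 2) * (1 - k.unpair.1 % 2)) :=
    Primrec.nat_mul.comp (Primrec.nat_div.comp h0 (Primrec.const 2))
      (Primrec.nat_sub.comp (Primrec.const 1) (Primrec.nat_mod.comp h0 (Primrec.const 2)))
  refine (h.to_comp.comp computable_ee).of_eq fun q => ?_
  simp only [ee, Nat.unpair_pair]
  rw [intEquivNat_toNat]

lemma computable_neg : Computable (fun q : ℚ => (-q.num).toNat) := by
  have h0 : Primrec (fun k : ℕ => k.unpair.1) := Primrec.fst.comp Primrec.unpair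
  have h : Primrec (fun k : ℕ => ((k.unpair.1 + 1) / 2) * (k.unpair.1 % 2)) :=
    Primrec.nat_mul.comp (Primrec.nat_div.comp (Primrec.succ.comp h0) (Primrec.const 2))
      (Primrec.nat_mod.comp h0 (Primrec.const 2))
  refine (h.to_comp.comp computable_ee).of_eq fun q => ?_
  simp only [ee, Nat.unpair_pair]
  rw [intEquivNat_neg_toNat]

lemma rat_parts (q : ℚ) : q * q.den = (q.num.toNat : ℚ) - ((-q.num).toNat : ℚ) := by
  rw [Rat.mul_den_eq_num]
  have : q.num = (q.num.toNat : ℤ) - ((-q.num).toNat : ℤ) := by omega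
  exact_mod_cast this

lemma computable_of_frac {α : Type*} [Primcodable α] {f : α → ℚ} {A B D : α → ℕ}
    (hA : Computable A) (hB : Computable B) (hD : Computable D) (hpos : ∀ a, 0 < D a)
    (h : ∀ a, f a * D a = (A a : ℚ) - B a) : Computable f := by
  rw [← Computable.encode_iff]
  let P : α → ℕ → Prop := fun a n =>
    (Denumerable.ofNat ℚ n).num.toNat * D a + B a * (Denumerable.ofNat ℚ n).den =
      A a * (Denumerable.ofNat ℚ n).den + (-(Denumerable.ofNat ℚ n).num).toNat * D a
  have key : ∀ a n, P a n ↔ Denumerable.ofNat ℚ n = f a := by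
    intro a n
    have h1 := rat_parts (Denumerable.ofNat ℚ n)
    have h2 := h a
    generalize hr : Denumerable.ofNat ℚ n = r at h1
    have hDp : (D a : ℚ) ≠ 0 := by exact_mod_cast (hpos a).ne'
    have hrd : (r.den : ℚ) ≠ 0 := by exact_mod_cast r.den_nz
    simp only [P, hr]
    rw [← Nat.cast_inj (R := ℚ)]
    push_cast
    constructor
    · intro e
      have : r * (r.den * D a) = f a * (r.den * D a) := by linear_combination D a * h1 + e - r.den * h2
      exact mul_right_cancel₀ (mul_ne_zero hrd hDp) this
    · intro e
      subst e
      linear_combination - D a * h1 + (f a).den * h2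
  have hex : ∀ a, ∃ n, P a n := fun a => ⟨encQ (f a), (key _ _).2 (Denumerable.ofNat_encode _)⟩
  have hP : ComputablePred (fun p : α × ℕ => P p.1 p.2) := by
    have hr : Computable (fun p : α × ℕ => Denumerable.ofNat ℚ p.2) :=
      (Computable.ofNat ℚ).comp Computable.snd
    have mul := Primrec.nat_mul.to_comp
    have add := Primrec.nat_add.to_comp
    have e : ComputablePred (fun p : ℕ × ℕ => p.1 = p.2) :=
      (Primrec.eq.comp Primrec.fst Primrec.snd).computablePred
    have g : Computable (fun p : α × ℕ =>
      ((Denumerable.ofNat ℚ p.2).num.toNat * D p.1 + B p.1 * (Denumerable.ofNat ℚ p.2).den,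
        A p.1 * (Denumerable.ofNat ℚ p.2).den + (-(Denumerable.ofNat ℚ p.2).num).toNat * D p.1)) :=
      Computable.pair
        (add.comp (mul.comp (computable_pos.comp hr) (hD.comp Computable.fst))
          (mul.comp (hB.comp Computable.fst) (computable_den.comp hr)))
        (add.comp (mul.comp (hA.comp Computable.fst) (computable_den.comp hr))
          (mul.comp (computable_neg.comp hr) (hD.comp Computable.fst)))
    exact (e.decide.comp g).computablePred
  refine (Computable.find hP hex).of_eq fun a => ?_
  have := (key _ _).1 (Nat.find_spec (hex a))
  rw [← this]
  exact (Denumerable.encode_ofNat _).symm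

lemma computable_rat_add : Computable₂ (fun a b : ℚ => a + b) := by
  have mul := Primrec.nat_mul.to_comp
  have add := Primrec.nat_add.to_comp
  have p1 := computable_pos.comp (Computable.fst (α := ℚ) (β := ℚ))
  have p2 := computable_pos.comp (Computable.snd (α := ℚ) (β := ℚ))
  have n1 := computable_neg.comp (Computable.fst (α := ℚ) (β := ℚ))
  have n2 := computable_neg.comp (Computable.snd (α := ℚ) (β := ℚ))
  have d1 := computable_den.comp (Computable.fst (α := ℚ) (β := ℚ))
  have d2 := computable_den.comp (Computable.snd (α := ℚ) (β := ℚ))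
  refine computable_of_frac (f := fun p : ℚ × ℚ => p.1 + p.2)
    (add.comp (mul.comp p1 d2) (mul.comp p2 d1)) (add.comp (mul.comp n1 d2) (mul.comp n2 d1))
    (mul.comp d1 d2) (fun p => Nat.mul_pos p.1.den_pos p.2.den_pos) fun p => ?_
  have h1 := rat_parts p.1
  have h2 := rat_parts p.2
  push_cast
  linear_combination p.2.den * h1 + p.1.den * h2

lemma computable_rat_mul : Computable₂ (fun a b : ℚ => a * b) := by
  have mul := Primrec.nat_mul.to_comp
  have add := Primrec.nat_add.to_comp
  have p1 := computable_pos.comp (Computable.fst (α := ℚ) (β := ℚ))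
  have p2 := computable_pos.comp (Computable.snd (α := ℚ) (β := ℚ))
  have n1 := computable_neg.comp (Computable.fst (α := ℚ) (β := ℚ))
  have n2 := computable_neg.comp (Computable.snd (α := ℚ) (β := ℚ))
  have d1 := computable_den.comp (Computable.fst (α := ℚ) (β := ℚ))
  have d2 := computable_den.comp (Computable.snd (α := ℚ) (β := ℚ))
  refine computable_of_frac (f := fun p : ℚ × ℚ => p.1 * p.2)
    (add.comp (mul.comp p1 p2) (mul.comp n1 n2)) (add.comp (mul.comp n1 p2) (mul.comp p1 n2))
    (mul.comp d1 d2) (fun p => Nat.mul_pos p.1.den_pos p.2.den_pos) fun p => ?_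
  have h1 := rat_parts p.1
  have h2 := rat_parts p.2
  push_cast
  linear_combination p.2 * p.2.den * h1 + ((p.1.num.toNat : ℚ) - ((-p.1.num).toNat : ℚ)) * h2

lemma primrec_two_pow : Primrec (fun n : ℕ => 2 ^ n) := by
  refine (Primrec.nat_rec₁ (f := fun _ r => 2 * r) 1
    (Primrec.nat_mul.comp (Primrec.const 2) Primrec.snd)).of_eq fun n => ?_
  induction n with
  | zero => rfl
  | succ n ih => simp only [] at ih ⊢; rw [ih, pow_succ]; ring

lemma computable_three_inv_pow : Computable (fun n : ℕ => (3 : ℚ) / 2 ^ n) := by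
  refine computable_of_frac (A := fun _ => 3) (B := fun _ => 0) (D := fun n => 2 ^ n)
    (Computable.const 3) (Computable.const 0) primrec_two_pow.to_comp (fun n => by positivity) ?_
  intro n
  have : (2 : ℚ) ^ n ≠ 0 := by positivity
  push_cast
  field_simp
  simp

end EncodeSection

/-- `ω` is Schnorr random for `φ` iff no computable nonnegative
supermartingale for `φ` is computably unbounded on `ω`. -/
theorem statement_2 (lo hi : Situation → ℝ) (hφ : IsForecastingSystem lo hi) (ω : BinPath) :
    SchnorrRandom lo hi ω ↔
      ∀ M : Situation → ℝ, IsComputableProcess M → (∀ s, 0 ≤ M s) →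
        IsSupermartingale lo hi M → ¬ ComputablyUnboundedOn M ω := by
  constructor
  · rintro hS M ⟨q, hq, hqM⟩ hM0 hM ⟨τ, ⟨hτ0, hτm, hτt, r, hr, hrτ⟩, hlim⟩
    have hq' : ∀ s n, |M s - q s n| < 1 / (2 : ℝ) ^ n := by
      intro s n; simpa using hqM s n
    let U : Situation → ℚ := fun s => q s s.length + 3 / 2 ^ s.length
    have hUc : Computable U := by
      have hlen : Computable (List.length : Situation → ℕ) := Computable.list_length
      exact computable_rat_add.comp (hq.comp Computable.id hlen)
        (computable_three_inv_pow.comp hlen)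
    have hUlo : ∀ s, M s + 2 / (2 : ℝ) ^ s.length < U s := by
      intro s
      have h := (abs_lt.1 (hq' s s.length)).2
      have e : (3 : ℝ) / 2 ^ s.length = 2 / 2 ^ s.length + 1 / 2 ^ s.length := by ring
      simp only [U]; push_cast
      rw [e]; linarith
    have hUhi : ∀ s, (U s : ℝ) < M s + 4 / (2 : ℝ) ^ s.length := by
      intro s
      have h := (abs_lt.1 (hq' s s.length)).1
      have e : (4 : ℝ) / 2 ^ s.length = 3 / 2 ^ s.length + 1 / 2 ^ s.length := by ring
      simp only [U]; push_cast
      rw [e]; linarith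
    have hUM : ∀ s, M s < U s := fun s => by
      have := hUlo s
      have : 0 < 2 / (2 : ℝ) ^ s.length := by positivity
      linarith
    have hUd : ∀ s x, (U (s ++ [x]) : ℝ) - U s ≤ M (s ++ [x]) - M s := by
      intro s x
      have h1 := hUhi (s ++ [x])
      have h2 := hUlo s
      have e : (4 : ℝ) / 2 ^ (s ++ [x]).length = 2 / 2 ^ s.length := by
        simp [pow_succ]; field_simp; norm_num
      rw [e] at h1; linarith
    obtain ⟨c, hc⟩ : ∃ c : ℚ, c = U [] := ⟨_, rfl⟩
    have hc1 : (1 : ℝ) ≤ c := by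
      have h1 := hUlo []
      have h2 := hM0 []
      rw [hc]; simp at h1; linarith
    have hc0 : (0 : ℝ) < c := by linarith
    have hqle : ∀ x y : ℝ, |x / c - y / c| ≤ |x - y| := by
      intro x y
      rw [← sub_div, abs_div, abs_of_pos hc0]
      exact div_le_self (abs_nonneg _) hc1
    refine hS (fun s => (U s : ℝ) / c) ⟨fun s => U s * c⁻¹, ?_, ?_⟩ ?_ ⟨?_, ?_, ?_⟩
      ⟨fun n => τ n / c, ⟨?_, ?_, ?_, fun n m => r n m * c⁻¹, ?_, ?_⟩, ?_⟩
    · exact computable_rat_mul.comp hUc (Computable.const _)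
    · intro s; push_cast; rw [div_eq_mul_inv]
    · intro s; exact div_pos ((hM0 s).trans_lt (hUM s)) hc0
    · intro s
      obtain ⟨p0, p1, p2⟩ := hφ s
      have key : ∀ p : ℝ, 0 ≤ p → p ≤ 1 → localE p (diffP M s) ≤ 0 →
          localE p (diffP (fun s => (U s : ℝ) / c) s) ≤ 0 := by
        intro p h0 h1 h
        have e : localE p (diffP (fun s => (U s : ℝ) / c) s) =
            (p * (U (s ++ [true]) - U s) + (1 - p) * (U (s ++ [false]) - U s)) / c := by
          simp only [localE, diffP]; ring
        rw [e]
        refine div_nonpos_of_nonpos_of_nonneg (le_trans ?_ h) hc0.le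
        have a1 := mul_le_mul_of_nonneg_left (hUd s true) h0
        have a2 := mul_le_mul_of_nonneg_left (hUd s false) (sub_nonneg.2 h1)
        simp only [localE, diffP]
        linarith
      have h := hM s
      exact max_le (key _ p0 (p1.trans p2) ((le_max_left _ _).trans h))
        (key _ (p0.trans p1) p2 ((le_max_right _ _).trans h))
    · intro s; exact (div_pos ((hM0 s).trans_lt (hUM s)) hc0).le
    · simp only []
      rw [← hc]; exact div_self hc0.ne'
    · intro n; exact div_nonneg (hτ0 n) hc0.le
    · intro n; exact div_le_div_of_nonneg_right (hτm n) hc0.le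
    · exact hτt.atTop_div_const hc0
    · exact computable_rat_mul.comp hr (Computable.const _)
    · intro n m
      have e : ((r n m * c⁻¹ : ℚ) : ℝ) = (r n m : ℝ) / c := by push_cast; rw [div_eq_mul_inv]
      rw [e]
      exact (hqle _ _).trans_lt (hrτ n m)
    · rw [le_limsup_iff] at hlim ⊢
      intro y hy
      refine (hlim y hy).mono fun n hn => ?_
      have e : (U (pref ω n) : ℝ) / c - τ n / c = (U (pref ω n) - τ n) / c := by ring
      rw [e]
      have hm := hUM (pref ω n)
      rcases le_or_gt 0 ((U (pref ω n) : ℝ) - τ n) with h | h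
      · refine hy.trans_le ?_
        exact_mod_cast div_nonneg h hc0.le
      · refine hn.trans_le ?_
        have : (U (pref ω n) : ℝ) - τ n ≤ (U (pref ω n) - τ n) / c := by
          rw [le_div_iff₀ hc0]; nlinarith
        have h3 : M (pref ω n) - τ n ≤ ((U (pref ω n) : ℝ) - τ n) / c := by linarith
        exact_mod_cast h3
  · rintro h T ⟨q, hq, hqT⟩ hpos ⟨hT, hT0, -⟩
    refine h T ⟨fun s _ => q s, hq.comp Computable.fst, fun s n => ?_⟩ hT0 hT
    rw [hqT, sub_self, abs_zero]
    positivity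
end

section
/- Let p, q ∈ [0,1] be rational numbers. Then the set 𝒮^{p,q}_{𝓕_C} consists exactly of all recursive temporal selection processes. -/
open Filter Classical

def rawQ (x : ℚ) : ℕ := @Encodable.encode ℚ Rat.instEncodable x

theorem dec_eq (P : Prop) (a b : Decidable P) : @decide P a = @decide P b := by
  cases Subsingleton.elim a b; rfl

theorem encQ_s13 (x : ℚ) : @Encodable.encode ℚ (Primcodable.ofDenumerable ℚ).toEncodable x = 
   (List.range (rawQ x)).countP (fun m => decide (m ∈ Set.range rawQ)) := by
  have : @Encodable.encode ℚ (Primcodable.ofDenumerable ℚ).toEncodable x = @List.countP ℕ (fun m => @decide (m ∈ Set.range rawQ) (@Encodable.decidableRangeEncode ℚ Rat.instEncodable m)) (List.range (rawQ x)) := rfl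
  rw [this]; congr!; exact dec_eq _ _ _
theorem rawQ_eq (x : ℚ) : rawQ x = Nat.pair (Encodable.encode x.num) x.den := rfl

theorem intEnc (z : ℤ) : z.natAbs = (Encodable.encode z + 1)/2 := by
  cases z with
  | ofNat n => 
    have : Encodable.encode (Int.ofNat n) = 2*n := rfl
    rw [this]; simp; omega
  | negSucc n => 
    have : Encodable.encode (Int.negSucc n) = 2*n+1 := rfl
    rw [this]; simp; omega

def isRaw (m : ℕ) : Prop := 0 < m.unpair.2 ∧ ∀ d < (m+2), d ∣ (m.unpair.1+1)/2 → d ∣ m.unpair.2 → d = 1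

theorem mem_raw (m : ℕ) : m ∈ Set.range rawQ ↔ isRaw m := by
  constructor
  · rintro ⟨x, rfl⟩
    simp only [isRaw, rawQ_eq, Nat.unpair_pair]
    refine ⟨x.den_pos, fun d _ h1 h2 => ?_⟩
    rw [← intEnc] at h1
    exact Nat.eq_one_of_dvd_coprimes x.reduced h1 h2
  · rintro ⟨h1, h2⟩
    set z : ℤ := Denumerable.ofNat ℤ m.unpair.1 with hz
    have e : Encodable.encode z = m.unpair.1 := Denumerable.encode_ofNat _
    refine ⟨⟨z, m.unpair.2, h1.ne', ?_⟩, ?_⟩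
    · rw [intEnc, e]
      refine h2 _ ?_ (Nat.gcd_dvd_left _ _) (Nat.gcd_dvd_right _ _)
      have := Nat.le_of_dvd h1 (Nat.gcd_dvd_right ((m.unpair.1+1)/2) _)
      have := Nat.unpair_right_le m
      omega
    · rw [rawQ_eq]; simp only [e]; simp
open Primrec in
theorem isRaw_prim : PrimrecPred isRaw := by
  have hdvd : PrimrecRel (fun a b : ℕ => a ∣ b) := 
    (PrimrecRel.comp (R := fun a b : ℕ => a = b) Primrec.eq (nat_mod.comp snd fst) (Primrec.const 0)).of_eq fun p => by
      simp [Nat.dvd_iff_mod_eq_zero]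
  have u1 : Primrec (fun m : ℕ => m.unpair.1) := fst.comp unpair
  have u2 : Primrec (fun m : ℕ => m.unpair.2) := snd.comp unpair
  have a : PrimrecPred (fun m : ℕ => 0 < m.unpair.2) := nat_lt.comp (Primrec.const 0) u2
  have R : PrimrecRel (fun d m : ℕ => d ∣ (m.unpair.1+1)/2 → d ∣ m.unpair.2 → d = 1) := by
    have r1 : PrimrecRel (fun d m : ℕ => d ∣ (m.unpair.1+1)/2) :=
      hdvd.comp fst (nat_div.comp (succ.comp (u1.comp snd)) (Primrec.const 2))
    have r2 : PrimrecRel (fun d m : ℕ => d ∣ m.unpair.2) :=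
      hdvd.comp fst (u2.comp snd)
    have r3 : PrimrecRel (fun d m : ℕ => d = 1) := Primrec.eq.comp fst (Primrec.const 1)
    exact ((PrimrecPred.or (PrimrecPred.not r1) (PrimrecPred.or (PrimrecPred.not r2) r3))).of_eq fun p => by tauto
  exact a.and (R.forall_lt.comp (succ.comp succ) Primrec.id)

theorem count_prim : Primrec (fun n : ℕ => (List.range n).countP (fun m => decide (m ∈ Set.range rawQ))) := by
  have := Primrec.list_length.comp ((Primrec.listFilter isRaw_prim).comp Primrec.list_range)
  refine this.of_eq fun n => ?_
  rw [List.countP_eq_length_filter]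
  simp only [mem_raw]

theorem comp_of_raw {f : ℕ → ℚ} (h : Primrec (fun a => rawQ (f a))) : Primrec f := by
  rw [← Primrec.encode_iff]
  exact (count_prim.comp h).of_eq fun a => (encQ_s13 _).symm

theorem cast_prim : Primrec (fun n : ℕ => (n : ℚ)) := by
  apply comp_of_raw
  refine (Primrec₂.natPair.comp (Primrec.nat_double) (Primrec.const 1)).of_eq fun n => ?_
  rfl

noncomputable def unraw (m : ℕ) : ℚ := if h : m ∈ Set.range rawQ then h.choose else 0

theorem rawQ_inj : Function.Injective rawQ := @Encodable.encode_injective ℚ Rat.instEncodable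

theorem unraw_raw (x : ℚ) : unraw (rawQ x) = x := by
  have h : rawQ x ∈ Set.range rawQ := ⟨x, rfl⟩
  rw [unraw, dif_pos h]
  exact rawQ_inj h.choose_spec

theorem unraw_prim : Primrec unraw := by
  apply comp_of_raw
  refine (Primrec.ite isRaw_prim Primrec.id (Primrec.const (rawQ 0))).of_eq fun m => ?_
  by_cases h : isRaw m
  · have h' := (mem_raw m).2 h
    rw [if_pos h, unraw, dif_pos h', h'.choose_spec]; rfl
  · have h' := fun h' => h ((mem_raw m).1 h')
    rw [if_neg h, unraw, dif_neg h']

theorem rawQ_comp : Computable rawQ := by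
  have hp : Computable₂ (fun (x : ℚ) (m : ℕ) => decide (isRaw m ∧ unraw m = x)) := by
    have : PrimrecPred (fun p : ℚ × ℕ => isRaw p.2 ∧ unraw p.2 = p.1) :=
      (isRaw_prim.comp Primrec.snd).and (Primrec.eq.comp (unraw_prim.comp Primrec.snd) Primrec.fst)
    exact (primrecPred_iff_primrec_decide.1 this).to_comp
  have := Partrec.rfind (p := fun x m => (Part.some (decide (isRaw m ∧ unraw m = x)))) hp
  refine Partrec.of_eq this fun x => ?_
  refine Part.eq_some_iff.2 (Nat.mem_rfind.2 ?_)
  refine ⟨?_, fun {m} hm => ?_⟩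
  · simp [unraw_raw, (mem_raw _).1 ⟨x, rfl⟩]
  · simp only [Part.mem_some_iff]
    symm
    rw [decide_eq_false_iff_not]
    rintro ⟨h1, rfl⟩
    obtain ⟨y, rfl⟩ := (mem_raw m).2 h1
    rw [unraw_raw] at hm
    exact hm.ne rfl

theorem den_comp : Computable (fun x : ℚ => x.den) := 
  ((Primrec.snd.comp Primrec.unpair).to_comp.comp rawQ_comp).of_eq fun x => by simp [rawQ_eq]
theorem num_comp : Computable (fun x : ℚ => x.num.natAbs) := 
  ((Primrec.nat_div.comp (Primrec.succ.comp (Primrec.fst.comp Primrec.unpair)) (Primrec.const 2)).to_comp.comp rawQ_comp).of_eq fun x => by simp [rawQ_eq, intEnc]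

/-- all strings of length `n` -/
def strs (n : ℕ) : List (List Bool) :=
  Nat.rec [[]] (fun _ L => L.flatMap fun t => [true :: t, false :: t]) n

theorem mem_strs (n : ℕ) (t : List Bool) : t ∈ strs n ↔ t.length = n := by
  induction n generalizing t with
  | zero => simp [strs]
  | succ n ih =>
    have : strs (n+1) = (strs n).flatMap fun t => [true :: t, false :: t] := rfl
    rw [this]
    cases t with
    | nil => simp
    | cons b t => cases b <;> simp [ih]

theorem strs_prim : Primrec strs := by
  refine Primrec.nat_rec₁ (α := List (List Bool)) [[]]
    (f := fun _ L => L.flatMap fun t => [true :: t, false :: t]) ?_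
  refine Primrec.list_flatMap (f := fun p : ℕ × List (List Bool) => p.2)
    (g := fun _ t => [true :: t, false :: t]) Primrec.snd ?_
  have h : ∀ b : Bool, Primrec (fun p : (ℕ × List (List Bool)) × List Bool => b :: p.2) :=
    fun b => Primrec.list_cons.comp (Primrec.const b) Primrec.snd
  exact Primrec.list_cons.comp (h true) (Primrec.list_cons.comp (h false) (Primrec.const []))

theorem comp_any {T : List Bool → Bool} (hT : Computable T) :
    Computable (fun L : List (List Bool) => L.any T) := by
  have h : Computable (fun L : List (List Bool) =>
      Nat.rec (motive := fun _ => Bool) false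
        (fun i acc => acc || (L[i]?.map T).getD false) L.length) := by
    refine Computable.nat_rec (σ := Bool) (f := fun L : List (List Bool) => L.length)
      (g := fun _ => false)
      (h := fun L p => p.2 || (L[p.1]?.map T).getD false)
      Computable.list_length (Computable.const false) ?_
    have h1 : Computable (fun q : List (List Bool) × (ℕ × Bool) => q.1[q.2.1]?) :=
      Computable.list_getElem?.comp Computable.fst (Computable.fst.comp Computable.snd)
    have h2 : Computable (fun q : List (List Bool) × (ℕ × Bool) => q.1[q.2.1]?.map T) :=
      Computable.option_map h1 (hT.comp Computable.snd).to₂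
    have h3 : Computable (fun q : List (List Bool) × (ℕ × Bool) =>
        (q.1[q.2.1]?.map T).getD false) :=
      Computable.option_getD h2 (Computable.const false)
    exact Primrec.or.to_comp.comp (Computable.snd.comp Computable.snd) h3
  refine h.of_eq fun L => ?_
  have key : ∀ n, Nat.rec (motive := fun _ => Bool) false
        (fun i acc => acc || (L[i]?.map T).getD false) n = (L.take n).any T := by
    intro n
    induction n with
    | zero => simp
    | succ n ih =>
      simp only [ih, List.take_add_one, List.any_append]
      congr 1
      cases L[n]? <;> simp
  rw [key, List.take_length]

theorem pos_cast (x : ℚ) (hx : 0 < x) : (x : ℝ) * x.den = x.num.natAbs := by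
  have h : x * x.den = x.num := Rat.mul_den_eq_num x
  have h2 : (x.num.natAbs : ℤ) = x.num := Int.natAbs_of_nonneg (Rat.num_pos.2 hx).le
  have h3 : x * x.den = ((x.num.natAbs : ℕ) : ℚ) := by
    rw [h, ← Int.cast_natCast (R := ℚ), h2]
  have h4 := congrArg (fun y : ℚ => (y : ℝ)) h3
  simpa only [Rat.cast_mul, Rat.cast_natCast] using h4

/-- natural number test for positivity of the local expectation -/
def tst (a c b n1 d1 n0 d0 n d : ℕ) : Prop := b * n * d1 * d0 < a * n1 * d0 * d + c * n0 * d1 * d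

theorem tst_iff (r : ℚ) (h0 : 0 ≤ r) (h1 : r ≤ 1) (x1 x0 x : ℚ) (p1 : 0 < x1) (p0 : 0 < x0)
    (p : 0 < x) :
    tst r.num.natAbs (r.den - r.num.natAbs) r.den x1.num.natAbs x1.den x0.num.natAbs x0.den
      x.num.natAbs x.den ↔ 0 < (r : ℝ) * ((x1 : ℝ) - x) + (1 - r) * ((x0 : ℝ) - x) := by
  have hr : (r : ℝ) * r.den = r.num.natAbs := by
    rcases h0.eq_or_lt with rfl | h
    · simp
    · exact pos_cast r h
  have dr : (0 : ℝ) < r.den := by exact_mod_cast r.den_pos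
  have d1 : (0 : ℝ) < x1.den := by exact_mod_cast x1.den_pos
  have d0 : (0 : ℝ) < x0.den := by exact_mod_cast x0.den_pos
  have d : (0 : ℝ) < x.den := by exact_mod_cast x.den_pos
  have hle : r.num.natAbs ≤ r.den := by
    have : (r : ℝ) ≤ 1 := by exact_mod_cast h1
    have : (r.num.natAbs : ℝ) ≤ r.den := by rw [← hr]; nlinarith
    exact_mod_cast this
  unfold tst
  rw [← Nat.cast_lt (α := ℝ)]
  push_cast [Nat.cast_sub hle]
  rw [← hr, ← pos_cast x1 p1, ← pos_cast x0 p0, ← pos_cast x p, ← sub_pos]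
  have e : (r : ℝ) * r.den * (x1 * x1.den) * x0.den * x.den
      + (r.den - r * r.den) * (x0 * x0.den) * x1.den * x.den
      - r.den * (x * x.den) * x1.den * x0.den
      = ((r.den : ℝ) * x1.den * x0.den * x.den) * ((r : ℝ) * ((x1 : ℝ) - x) + (1 - r) * ((x0 : ℝ) - x)) := by
    ring
  rw [e]
  exact mul_pos_iff_of_pos_left (by positivity)

theorem selProc_comp (r : ℚ) (h0 : 0 ≤ r) (h1 : r ≤ 1) (F : Situation → ℝ) (hF : F ∈ FsetC) :
    Computable (selProc r F) := by
  obtain ⟨⟨q, hq, hqF⟩, hpos, -⟩ := hF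
  have qpos : ∀ s, 0 < q s := fun s => by
    have := hpos s; rw [← hqF] at this; exact_mod_cast this
  have hsnoc : ∀ b : Bool, Computable (fun t : List Bool => q (t ++ [b])) := fun b =>
    hq.comp (Computable.list_append.comp Computable.id (Computable.const [b]))
  have M : ∀ {f g : List Bool → ℕ}, Computable f → Computable g →
      Computable (fun t => f t * g t) := fun hf hg => Primrec.nat_mul.to_comp.comp hf hg
  have C : ∀ n : ℕ, Computable (fun _ : List Bool => n) := fun n => Computable.const n
  let T : List Bool → Bool := fun t => decide (tst r.num.natAbs (r.den - r.num.natAbs) r.den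
    (q (t ++ [true])).num.natAbs (q (t ++ [true])).den
    (q (t ++ [false])).num.natAbs (q (t ++ [false])).den (q t).num.natAbs (q t).den)
  have hT : Computable T := by
    have n1 := num_comp.comp (hsnoc true)
    have d1 := den_comp.comp (hsnoc true)
    have n0 := num_comp.comp (hsnoc false)
    have d0 := den_comp.comp (hsnoc false)
    have n := num_comp.comp hq
    have d := den_comp.comp hq
    have lhs := M (M (M (C r.den) n) d1) d0
    have rhs := Primrec.nat_add.to_comp.comp
      (M (M (M (C r.num.natAbs) n1) d0) d) (M (M (M (C (r.den - r.num.natAbs)) n0) d1) d)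
    have lt : Computable₂ (fun a b : ℕ => decide (a < b)) :=
      (primrecRel_iff_primrec_decide.1 Primrec.nat_lt).to_comp
    exact (lt.comp lhs rhs).of_eq fun t => by
      exact dec_eq _ _ _
  refine ((comp_any hT).comp (strs_prim.to_comp.comp Computable.list_length)).of_eq fun s => ?_
  rw [Bool.eq_iff_iff, List.any_eq_true]
  simp only [selProc, mem_strs, T, decide_eq_true_eq]
  rw [show ∀ P : Prop, ((if P then true else false) = true ↔ P) from fun P => by by_cases P <;> simp [*]]
  refine exists_congr fun t => and_congr_right fun _ => ?_
  rw [tst_iff r h0 h1 _ _ _ (qpos _) (qpos _) (qpos _)]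
  simp only [localE, diffP, hqF]

/-- string of `n` ones -/
def ones (n : ℕ) : List Bool := Nat.rec [] (fun _ l => true :: l) n

theorem ones_len (n : ℕ) : (ones n).length = n := by
  induction n with
  | zero => rfl
  | succ n ih =>
    have : ones (n+1) = true :: ones n := rfl
    simp [this, ih]

theorem ones_prim : Primrec ones :=
  Primrec.nat_rec₁ (α := List Bool) [] (f := fun _ l => true :: l)
    (Primrec.list_cons.comp (Primrec.const true) Primrec.snd)

/-- one plus the number of selected times before `n` -/
def cnt (S : Situation → Bool) (n : ℕ) : ℕ :=
  Nat.rec 1 (fun k acc => acc + cond (S (ones k)) 1 0) n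

theorem cnt_succ (S : Situation → Bool) (n : ℕ) :
    cnt S (n+1) = cnt S n + cond (S (ones n)) 1 0 := rfl

theorem cnt_pos (S : Situation → Bool) (n : ℕ) : 0 < cnt S n := by
  induction n with
  | zero => exact Nat.one_pos
  | succ n ih => rw [cnt_succ]; omega

theorem cnt_comp {S : Situation → Bool} (hS : Computable S) : Computable (cnt S) := by
  refine Computable.nat_rec (σ := ℕ) (f := fun n : ℕ => n) (g := fun _ => 1)
    (h := fun _ p => p.2 + cond (S (ones p.1)) 1 0) Computable.id (Computable.const 1) ?_
  have k : Computable (fun p : ℕ × (ℕ × ℕ) => p.2.1) := Computable.fst.comp Computable.snd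
  have acc : Computable (fun p : ℕ × (ℕ × ℕ) => p.2.2) := Computable.snd.comp Computable.snd
  exact Primrec.nat_add.to_comp.comp acc
    (Computable.cond (hS.comp (ones_prim.to_comp.comp k)) (Computable.const 1) (Computable.const 0))

theorem selProc_cnt {S : Situation → Bool} (hT : IsTemporal S) (r : ℝ) :
    S = selProc r (fun s => (cnt S s.length : ℝ)) := by
  funext s
  have e : ∀ t : Situation, localE r (diffP (fun s => (cnt S s.length : ℝ)) t)
      = cond (S t) 1 0 := by
    intro t
    have : S (ones t.length) = S t := hT _ _ (ones_len _)
    simp only [localE, diffP, List.length_append, List.length_singleton, cnt_succ, this]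
    cases S t <;> simp
  simp only [selProc, e]
  cases h : S s with
  | true =>
    rw [if_pos ⟨s, rfl, by simp [h]⟩]
  | false =>
    rw [if_neg]
    rintro ⟨t, ht, h2⟩
    rw [hT t s ht, h] at h2
    simp at h2

/-- for rational `p, q ∈ [0,1]`, the set `𝒮^{p,q}_{𝓕_C}` consists
exactly of all recursive temporal selection processes. -/
theorem statement_13 (p q : ℚ) (hp0 : 0 ≤ p) (hp1 : p ≤ 1) (hq0 : 0 ≤ q) (hq1 : q ≤ 1) :
    SelSet (p : ℝ) (q : ℝ) FsetC =
      {S : Situation → Bool | Computable S ∧ IsTemporal S} := by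
  ext S
  constructor
  · rintro ⟨F, hF, r, hr, rfl⟩
    refine ⟨?_, ?_⟩
    · rcases hr with rfl | rfl
      · exact selProc_comp p hp0 hp1 F hF
      · exact selProc_comp q hq0 hq1 F hF
    · intro s t h
      simp only [selProc, h]
  · rintro ⟨hS, hT⟩
    refine ⟨fun s => (cnt S s.length : ℝ), ⟨⟨fun s => (cnt S s.length : ℚ), ?_, ?_⟩, ?_, ?_⟩,
      p, Or.inl rfl, selProc_cnt hT _⟩
    · exact cast_prim.to_comp.comp ((cnt_comp hS).comp Computable.list_length)
    · intro s; simp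
    · intro s; exact Nat.cast_pos.2 (cnt_pos S _)
    · simp [cnt]
end

section
/- Let p, q be real numbers with 0 ≤ p < q ≤ 1, let I ⊆ (0,1) be an interval forecast contained in the open unit interval, let 𝒮 be a countable set of selection processes with 𝒮 ⊇ 𝒮^{p,q}_{𝓕_C}, and let ϖ ∈ Ω be a path that is 𝒮-random for the stationary forecasting system I. Then a path ω ∈ Ω is C-random for the temporal precise forecasting system φ^ϖ_{p,q} if and only if ω is C-random for the stationary interval forecast [p,q]. -/
open Filter Classical

/-- auxiliary injective code of a rational -/
def ratCode (q : ℚ) : ℕ := Nat.pair (@Encodable.encode ℤ Int.encodable q.num) q.den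

theorem encInt (z : ℤ) : (@Encodable.encode ℤ Int.encodable z + 1) / 2 = z.natAbs := by
  cases z with
  | ofNat n => 
    have : @Encodable.encode ℤ Int.encodable (Int.ofNat n) = 2 * n := rfl
    rw [this]; simp; omega
  | negSucc n => 
    have : @Encodable.encode ℤ Int.encodable (Int.negSucc n) = 2 * n + 1 := rfl
    rw [this]; simp; omega

theorem encIntMod (z : ℤ) : @Encodable.encode ℤ Int.encodable z % 2 = 0 ↔ 0 ≤ z := by
  cases z with
  | ofNat n => 
    have : @Encodable.encode ℤ Int.encodable (Int.ofNat n) = 2 * n := rfl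
    rw [this]; simp
  | negSucc n => 
    have : @Encodable.encode ℤ Int.encodable (Int.negSucc n) = 2 * n + 1 := rfl
    rw [this]; simp

theorem encIntSurj (n : ℕ) : ∃ z : ℤ, @Encodable.encode ℤ Int.encodable z = n := 
  ⟨Equiv.intEquivNat.symm n, Equiv.intEquivNat.apply_symm_apply n⟩

theorem rat_encode_eq (q : ℚ) : @Encodable.encode ℚ Primcodable.toEncodable q =
   (@List.countP ℕ (fun m => decide (m ∈ Set.range ratCode)) (List.range (ratCode q)) ) := by
  have : @Encodable.encode ℚ Primcodable.toEncodable q =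
   (@List.countP ℕ (fun m => @decide (m ∈ Set.range ratCode) (@Encodable.decidableRangeEncode ℚ Rat.instEncodable m)) (List.range (ratCode q)) ) := rfl
  rw [this]
  refine congrArg (fun g : ℕ → Bool => List.countP g (List.range (ratCode q))) (funext fun m => ?_)
  exact decide_eq_decide.2 Iff.rfl

theorem mem_range_ratCode (n : ℕ) : n ∈ Set.range ratCode ↔
    0 < n.unpair.2 ∧ ∀ x < n + 1, x ∣ (n.unpair.1 + 1) / 2 → x ∣ n.unpair.2 → x = 1 := by
  constructor
  · rintro ⟨q, rfl⟩
    simp only [ratCode, Nat.unpair_pair, encInt]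
    refine ⟨q.pos, fun x _ h1 h2 => ?_⟩
    exact Nat.dvd_one.1 (q.reduced ▸ Nat.dvd_gcd h1 h2)
  · rintro ⟨h1, h2⟩
    obtain ⟨z, hz⟩ := encIntSurj n.unpair.1
    rw [← hz, encInt] at h2
    refine ⟨⟨z, n.unpair.2, h1.ne', ?_⟩, ?_⟩
    · refine h2 _ ?_ (Nat.gcd_dvd_left _ _) (Nat.gcd_dvd_right _ _)
      have := Nat.le_of_dvd h1 (Nat.gcd_dvd_right z.natAbs n.unpair.2)
      have := Nat.unpair_right_le n
      omega
    · simp [ratCode, hz]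

theorem primrec_dvd : PrimrecRel (fun a b : ℕ => a ∣ b) :=
  PrimrecRel.of_eq (r := fun a b : ℕ => b % a = 0)
    (Primrec.eq.comp (Primrec.nat_mod.comp Primrec.snd Primrec.fst) (Primrec.const 0))
    (fun _ _ => (Nat.dvd_iff_mod_eq_zero).symm)

theorem primrec_mem : PrimrecPred (fun n => n ∈ Set.range ratCode) := by
  refine PrimrecPred.of_eq ?_ (fun n => (mem_range_ratCode n).symm)
  have u1 : Primrec (fun n : ℕ => n.unpair.1) := Primrec.fst.comp Primrec.unpair
  have u2 : Primrec (fun n : ℕ => n.unpair.2) := Primrec.snd.comp Primrec.unpair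
  refine PrimrecPred.and (Primrec.nat_lt.comp (Primrec.const 0) u2) ?_
  have key : PrimrecRel (fun x n : ℕ => x ∣ (n.unpair.1 + 1) / 2 → x ∣ n.unpair.2 → x = 1) := by
    have h : PrimrecPred (fun a : ℕ × ℕ => (¬ a.1 ∣ (a.2.unpair.1 + 1) / 2) ∨
        ((¬ a.1 ∣ a.2.unpair.2) ∨ a.1 = 1)) := by
      refine PrimrecPred.or (PrimrecPred.not (primrec_dvd.comp Primrec.fst ?_))
        (PrimrecPred.or (PrimrecPred.not (primrec_dvd.comp Primrec.fst (u2.comp Primrec.snd))) 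
        (Primrec.eq.comp Primrec.fst (Primrec.const 1)))
      exact Primrec.nat_div.comp (Primrec.succ.comp (u1.comp Primrec.snd)) (Primrec.const 2)
    exact h.of_eq (fun a => by tauto)
  exact (key.forall_lt).comp Primrec.succ Primrec.id

/-- rank of a number in the range of `ratCode` -/
noncomputable def rankC (n : ℕ) : ℕ :=
  (@List.countP ℕ (fun m => decide (m ∈ Set.range ratCode)) (List.range n))

theorem primrec_rank : Primrec rankC := by
  refine ((Primrec.list_length).comp ((Primrec.listFilter primrec_mem).comp
    Primrec.list_range)).of_eq ?_
  intro n
  simp only [rankC, List.countP_eq_length_filter]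
  

theorem rank_code (q : ℚ) : rankC (ratCode q) = @Encodable.encode ℚ Primcodable.toEncodable q :=
  (rat_encode_eq q).symm

theorem computable_search {α β : Type*} [Primcodable α] [Denumerable β] (f : α → β)
    (R : α → β → Prop) (hR : PrimrecRel R) (h : ∀ a b, R a b ↔ b = f a) : Computable f := by
  obtain ⟨_, hR⟩ := hR
  have h1 : Computable₂ (fun (a : α) (n : ℕ) => decide (R a (Denumerable.ofNat β n))) :=
    (hR.to_comp.comp (Computable.fst.pair ((Computable.ofNat β).comp Computable.snd))).of_eq
      (fun _ => decide_eq_decide.2 Iff.rfl)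
  have h2 := (Partrec.rfind (Computable₂.partrec₂ h1)).map
    (((Computable.ofNat β).comp Computable.snd).to₂ : Computable₂ (fun (_ : α) n => Denumerable.ofNat β n))
  refine h2.of_eq_tot fun a => ?_
  rw [Part.mem_map_iff]
  refine ⟨Encodable.encode (f a), ?_, by simp⟩
  rw [Nat.mem_rfind]
  constructor
  · simp [h]
  · intro m hm
    simp only [PFun.coe_val, Part.mem_some_iff, h]
    symm
    rw [decide_eq_false_iff_not]
    intro h
    rw [← h] at hm
    simp at hm

theorem ratCode_inj {x y : ℚ} : ratCode x = ratCode y ↔ x = y := by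
  refine ⟨fun h => ?_, fun h => h ▸ rfl⟩
  have := congrArg rankC h
  rw [rank_code, rank_code] at this
  exact @Encodable.encode_injective ℚ Primcodable.toEncodable _ _ this

theorem computable_ratCode : Computable ratCode := by
  refine computable_search ratCode
    (fun q n => n ∈ Set.range ratCode ∧ rankC n = @Encodable.encode ℚ Primcodable.toEncodable q) ?_ ?_
  · exact PrimrecPred.and (primrec_mem.comp Primrec.snd)
      (Primrec.eq.comp (primrec_rank.comp Primrec.snd) (Primrec.encode.comp Primrec.fst))
  · intro q n
    constructor
    · rintro ⟨⟨r, rfl⟩, h⟩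
      rw [rank_code] at h
      rw [@Encodable.encode_injective ℚ Primcodable.toEncodable _ _ h]
    · rintro rfl
      exact ⟨⟨q, rfl⟩, rank_code q⟩

theorem computable_div {α : Type*} [Primcodable α] (f : α → ℚ) (hf : Computable f)
    (hpos : ∀ a, 0 < f a) (k : ℕ) (hk : 0 < k) : Computable (fun a => f a / k) := by
  -- code-level function
  let R : ℕ → ℕ → Prop := fun m n => n ∈ Set.range ratCode ∧ n.unpair.1 % 2 = 0 ∧
    (n.unpair.1 + 1) / 2 * (m.unpair.2 * k) = (m.unpair.1 + 1) / 2 * n.unpair.2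
  have hRp : PrimrecRel R := by
    have u1 : Primrec (fun n : ℕ => n.unpair.1) := Primrec.fst.comp Primrec.unpair
    have u2 : Primrec (fun n : ℕ => n.unpair.2) := Primrec.snd.comp Primrec.unpair
    have u3 : Primrec (fun n : ℕ => (n.unpair.1 + 1) / 2) := 
      Primrec.nat_div.comp (Primrec.succ.comp u1) (Primrec.const 2)
    refine PrimrecPred.and (primrec_mem.comp Primrec.snd) (PrimrecPred.and 
      (Primrec.eq.comp (Primrec.nat_mod.comp (u1.comp Primrec.snd) (Primrec.const 2)) (Primrec.const 0))
      (Primrec.eq.comp (Primrec.nat_mul.comp (u3.comp Primrec.snd) 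
        (Primrec.nat_mul.comp (u2.comp Primrec.fst) (Primrec.const k)))
        (Primrec.nat_mul.comp (u3.comp Primrec.fst) (u2.comp Primrec.snd))))
  have hRs : ∀ x y : ℚ, 0 < x → (R (ratCode x) (ratCode y) ↔ y = x / k) := by
    intro x y hx
    have hxn : 0 < x.num := Rat.num_pos.2 hx
    have hkq : (0 : ℚ) < k := by exact_mod_cast hk
    have hd1 : (0 : ℚ) < x.den := by exact_mod_cast x.pos
    have hd2 : (0 : ℚ) < y.den := by exact_mod_cast y.pos
    have e1 : (x.num : ℚ) = x * x.den := (Rat.mul_den_eq_num x).symm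
    have e2 : (y.num : ℚ) = y * y.den := (Rat.mul_den_eq_num y).symm
    have key : 0 ≤ y.num → (y.num.natAbs * (x.den * k) = x.num.natAbs * y.den ↔ y = x / k) := by
      intro hy
      have c1 : ((y.num.natAbs : ℕ) : ℚ) = y.num := by
        rw [Nat.cast_natAbs, abs_of_nonneg hy]
      have c2 : ((x.num.natAbs : ℕ) : ℚ) = x.num := by
        rw [Nat.cast_natAbs, abs_of_nonneg hxn.le]
      rw [← Nat.cast_inj (R := ℚ)]
      rw [Nat.cast_mul, Nat.cast_mul, Nat.cast_mul, c1, c2, e1, e2, eq_div_iff hkq.ne']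
      constructor
      · intro h
        have : (y * k) * (x.den * y.den) = x * (x.den * y.den) := by linarith
        exact mul_right_cancel₀ (by positivity) this
      · intro h
        rw [← h]; ring
    simp only [R, ratCode, Nat.unpair_pair, encInt, encIntMod]
    constructor
    · rintro ⟨_, h1, h2⟩
      exact (key h1).1 h2
    · intro h
      have h1 : 0 ≤ y.num := Rat.num_nonneg.2 (by rw [h]; positivity)
      exact ⟨⟨y, rfl⟩, h1, (key h1).2 h⟩
  obtain ⟨_, hRd⟩ := hRp
  have h1 : Computable₂ (fun (a : α) (n : ℕ) => decide (R (ratCode (f a)) n)) :=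
    (hRd.to_comp.comp (((computable_ratCode.comp hf).comp Computable.fst).pair
      Computable.snd)).of_eq (fun _ => decide_eq_decide.2 Iff.rfl)
  have h2 := (Partrec.rfind (Computable₂.partrec₂ h1))
  have h3 : Computable (fun a => ratCode (f a / k)) := by
    refine h2.of_eq_tot fun a => ?_
    rw [Nat.mem_rfind]
    constructor
    · simp [hRs _ _ (hpos a)]
    · intro m hm
      simp only [PFun.coe_val, Part.mem_some_iff]
      symm
      rw [decide_eq_false_iff_not]
      intro h
      obtain ⟨y, rfl⟩ := h.1
      rw [hRs _ _ (hpos a)] at h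
      rw [h] at hm
      exact lt_irrefl _ hm
  rw [← Computable.encode_iff]
  exact (primrec_rank.to_comp.comp h3).of_eq (fun a => rank_code _)

theorem pref_length (ω : BinPath) (n : ℕ) : (pref ω n).length = n := by simp [pref]

theorem sel_finite (S : Situation → Bool) (ω : BinPath)
    (h : ¬ Tendsto (fun n => ∑ k ∈ Finset.range n, selVal S ω k) atTop atTop) :
    ∀ᶠ n in atTop, S (pref ω n) = false := by
  have h0 : ∀ n, 0 ≤ selVal S ω n := by
    intro n; unfold selVal; split_ifs <;> norm_num
  rw [← not_summable_iff_tendsto_nat_atTop_of_nonneg h0, not_not] at h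
  filter_upwards [h.tendsto_atTop_zero.eventually_lt_const (show (0:ℝ) < 1 by norm_num)] with n hn
  by_contra hc
  simp only [Bool.not_eq_false] at hc
  simp [selVal, hc] at hn

theorem ratio_tendsto (a b : ℕ → ℝ) (c : ℝ) (hab : ∀ k, a k * b k = a k * c)
    (h : Tendsto (fun n => ∑ k ∈ Finset.range n, a k) atTop atTop) :
    Tendsto (fun n => (((∑ k ∈ Finset.range n, a k * b k) /
      (∑ k ∈ Finset.range n, a k) : ℝ) : EReal)) atTop (nhds (c : EReal)) := by
  refine tendsto_const_nhds.congr' ?_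
  filter_upwards [h.eventually_gt_atTop 0] with n hn
  congr 1
  simp only [hab]
  rw [← Finset.sum_mul, mul_div_cancel_left₀ _ hn.ne']

theorem selProc_false {r : ℝ} {F : Situation → ℝ} {s : Situation} (h : selProc r F s = false) :
    ∀ t : Situation, t.length = s.length → localE r (diffP F t) ≤ 0 := by
  intro t ht
  by_contra hc
  have : selProc r F s = true := if_pos ⟨t, ht, not_le.1 hc⟩
  rw [h] at this
  exact Bool.noConfusion this

theorem selProc_true {r : ℝ} {F : Situation → ℝ} {s : Situation} (h : selProc r F s = true) :
    ∃ t : Situation, t.length = s.length ∧ 0 < localE r (diffP F t) := by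
  by_contra hc
  have : selProc r F s = false := if_neg hc
  rw [h] at this
  exact Bool.noConfusion this

theorem localE_between {p q r : ℝ} (hpr : p ≤ r) (hrq : r ≤ q) {f : Bool → ℝ}
    (h : upperE p q f ≤ 0) : localE r f ≤ 0 := by
  have h1 := (max_le_iff.1 h).1
  have h2 := (max_le_iff.1 h).2
  unfold localE at *
  rcases le_total (f true) (f false) with hf | hf <;> nlinarith

theorem unbounded_scale (T T' : Situation → ℝ) (ω : BinPath) (k : ℝ) (hk : 0 < k) (N : ℕ)
    (h : ∀ s : Situation, N ≤ s.length → T' s = T s / k) (hT : UnboundedOn T ω) :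
    UnboundedOn T' ω := by
  unfold UnboundedOn at *
  rw [EReal.eq_top_iff_forall_lt]
  intro y
  have hlt : (((y + 1) * k : ℝ) : EReal) <
      limsup (fun n => ((T (pref ω n) : ℝ) : EReal)) atTop := by
    rw [hT]; exact EReal.coe_lt_top _
  have hf := (frequently_lt_of_lt_limsup (by isBoundedDefault) hlt).and_eventually
    (eventually_ge_atTop N)
  have : ((y + 1 : ℝ) : EReal) ≤ limsup (fun n => ((T' (pref ω n) : ℝ) : EReal)) atTop := by
    refine le_limsup_of_frequently_le (hf.mono ?_) (by isBoundedDefault)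
    rintro n ⟨h1, h2⟩
    rw [h _ (by rw [pref_length]; exact h2)]
    rw [EReal.coe_lt_coe_iff] at h1
    rw [EReal.coe_le_coe_iff, le_div_iff₀ hk]
    exact h1.le
  refine lt_of_lt_of_le ?_ this
  rw [EReal.coe_lt_coe_iff]
  linarith

theorem crandom_back (p q : ℝ) (hp0 : 0 ≤ p) (hq0 : 0 ≤ q) (hp1 : p ≤ 1) (hq1 : q ≤ 1)
    (T : Situation → ℝ) (hrec : IsRecursiveRational T) (hpos : ∀ s, 0 < T s) (N : ℕ)
    (hN : ∀ s : Situation, N ≤ s.length → upperE p q (diffP T s) ≤ 0)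
    (ω : BinPath) (hω : CRandom (fun _ => p) (fun _ => q) ω) : ¬ UnboundedOn T ω := by
  intro hU
  obtain ⟨Q, hQc, hQ⟩ := hrec
  have hQpos : ∀ s, 0 < Q s := by
    intro s
    have := hpos s
    rw [← hQ] at this
    exact_mod_cast this
  set M := N + 1 with hM
  obtain ⟨B, hB⟩ := ((List.finite_length_eq Bool M).image T).bddAbove
  obtain ⟨k0, hk0⟩ := exists_nat_ge B
  set k := k0 + 1 with hkdef
  have hk : 0 < k := Nat.succ_pos _
  have hkR : (0 : ℝ) < k := by exact_mod_cast hk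
  have hbd : ∀ s : Situation, s.length = M → T s / k ≤ 1 := by
    intro s hs
    rw [div_le_one hkR]
    have h1 : T s ≤ B := hB ⟨s, hs, rfl⟩
    have h2 : (k : ℝ) = k0 + 1 := by rw [hkdef]; push_cast; ring
    linarith
  let Q' : Situation → ℚ := fun s => cond (decide (s.length < M)) 1 (Q s / k)
  have hQ'c : Computable Q' := by
    refine Computable.cond ?_ (Computable.const 1) (computable_div Q hQc hQpos k hk)
    have := (Primrec.nat_lt.comp (Primrec.list_length (α := Bool)) (Primrec.const M)).decide
    exact this.to_comp.of_eq (fun _ => decide_eq_decide.2 Iff.rfl)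
  let T' : Situation → ℝ := fun s => (Q' s : ℝ)
  have hlt : ∀ s : Situation, s.length < M → T' s = 1 := by
    intro s hs
    simp [T', Q', hs]
  have hge : ∀ s : Situation, M ≤ s.length → T' s = T s / k := by
    intro s hs
    simp [T', Q', not_lt.2 hs, hQ]
  have hT'pos : ∀ s, 0 < T' s := by
    intro s
    rcases lt_or_ge s.length M with h | h
    · rw [hlt s h]; norm_num
    · rw [hge s h]; exact div_pos (hpos s) hkR
  refine hω T' ⟨Q', hQ'c, fun s => rfl⟩ hT'pos ⟨?_, fun s => (hT'pos s).le, hlt [] ?_⟩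
    (unbounded_scale T T' ω k hkR M hge hU)
  · intro s
    show upperE p q (diffP T' s) ≤ 0
    rcases lt_or_ge s.length M with h | h
    · have hd : ∀ x, diffP T' s x ≤ 0 := by
        intro x
        have hle : T' (s ++ [x]) ≤ 1 := by
          rcases lt_or_ge (s ++ [x]).length M with h' | h'
          · rw [hlt _ h']
          · rw [hge _ h']
            refine hbd _ ?_
            simp only [List.length_append, List.length_singleton] at h' ⊢
            omega
        unfold diffP
        rw [hlt s h]
        linarith
      have h1 := hd true
      have h2 := hd false
      refine max_le ?_ ?_ <;> unfold localE <;> nlinarith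
    · have hd : ∀ x, diffP T' s x = diffP T s x / k := by
        intro x
        unfold diffP
        rw [hge s h, hge (s ++ [x]) (by simp; omega)]
        ring
      have hs := max_le_iff.1 (hN s (by omega))
      have e : ∀ r, localE r (diffP T' s) = localE r (diffP T s) / k := by
        intro r
        unfold localE
        rw [hd, hd]; ring
      refine max_le ?_ ?_
      · rw [e]; exact div_nonpos_of_nonpos_of_nonneg hs.1 hkR.le
      · rw [e]; exact div_nonpos_of_nonpos_of_nonneg hs.2 hkR.le
  · simp [hM]

/-- main theorem, case R = C: if `ϖ` is `𝒮`-random for a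
stationary interval forecast `I ⊆ (0,1)` with `𝒮 ⊇ 𝒮^{p,q}_{𝓕_C}` countable,
then a path is C-random for `φ^ϖ_{p,q}` iff it is C-random for `[p,q]`. -/
theorem statement_17 (p q : ℝ) (hp0 : 0 ≤ p) (hpq : p < q) (hq1 : q ≤ 1)
    (ilo ihi : ℝ) (h0 : 0 < ilo) (hle : ilo ≤ ihi) (h1 : ihi < 1)
    (𝒮 : Set (Situation → Bool)) (hc : 𝒮.Countable) (hsub : SelSet p q FsetC ⊆ 𝒮)
    (ϖ : BinPath) (hϖ : SSetRandom 𝒮 (fun _ => ilo) (fun _ => ihi) ϖ)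
    (ω : BinPath) :
    CRandom (tempFS p q ϖ) (tempFS p q ϖ) ω ↔ CRandom (fun _ => p) (fun _ => q) ω := by
  constructor
  · intro h T hrec hpos hT
    refine h T hrec hpos ⟨fun s => ?_, hT.2⟩
    have hs : upperE p q (diffP T s) ≤ 0 := hT.1 s
    refine max_le ?_ ?_ <;>
    · refine localE_between ?_ ?_ hs <;> unfold tempFS <;> split_ifs <;> linarith
  · intro h T hrec hpos hT
    have hF : T ∈ FsetC := ⟨hrec, hpos, hT.2.2⟩
    have hloc : ∀ s, localE (tempFS p q ϖ s) (diffP T s) ≤ 0 := fun s =>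
      (max_le_iff.1 (hT.1 s)).1
    have hP : ∀ᶠ n in atTop, selProc p T (pref ϖ n) = false := by
      refine sel_finite _ _ fun hten => ?_
      have hr := (hϖ _ (hsub ⟨T, hF, p, by simp, rfl⟩) hten).2
      rw [(ratio_tendsto _ _ (1 - ihi) ?_ hten).limsup_eq] at hr
      · have : (1 - ihi : ℝ) ≤ 0 := by exact_mod_cast hr
        linarith
      · intro k
        unfold selVal
        split_ifs with hs
        · obtain ⟨t, ht, hpt⟩ := selProc_true hs
          rw [pref_length] at ht
          have h2 := hloc t
          unfold tempFS at h2
          rw [ht] at h2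
          cases hk : ϖ k with
          | true => simp [bit]
          | false =>
            rw [hk] at h2
            simp only [Bool.false_eq_true, if_false] at h2
            linarith
        · simp
    have hQ : ∀ᶠ n in atTop, selProc q T (pref ϖ n) = false := by
      refine sel_finite _ _ fun hten => ?_
      have hr := (hϖ _ (hsub ⟨T, hF, q, by simp, rfl⟩) hten).1
      rw [(ratio_tendsto _ _ (0 - ilo) ?_ hten).liminf_eq] at hr
      · have : (0 : ℝ) ≤ 0 - ilo := by exact_mod_cast hr
        linarith
      · intro k
        unfold selVal
        split_ifs with hs
        · obtain ⟨t, ht, hpt⟩ := selProc_true hs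
          rw [pref_length] at ht
          have h2 := hloc t
          unfold tempFS at h2
          rw [ht] at h2
          cases hk : ϖ k with
          | false => simp [bit]
          | true =>
            rw [hk] at h2
            simp only [if_true] at h2
            linarith
        · simp
    obtain ⟨N, hN⟩ := eventually_atTop.1 (hP.and hQ)
    refine crandom_back p q hp0 (by linarith) (by linarith) hq1 T hrec hpos N ?_ ω h
    intro s hs
    have hh := hN s.length hs
    exact max_le (selProc_false hh.1 s (pref_length _ _).symm)
      (selProc_false hh.2 s (pref_length _ _).symm)
end
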